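/- arXiv:2210.04956 — 4 statements merged into one kernel-verified Lean document; each statement's English description precedes it below -/
import Mathlib

section
/- Let k̂ be a unit vector in ℝ³, let a : [0,∞) → [0,∞) be continuous with a(0) > 0, and let α ∈ [0,2). Then the total scattering cross section is infinite: ∫_{S²} a(‖p̂ − k̂‖)/‖p̂ − k̂‖^{2+α} dσ(p̂) = +∞, where the integral is over the unit sphere S² with its surface measure σ. (This is the vanishing mean free time property (1/t₀ = +∞) of the singular scattering kernel Φ(|p̂−k̂|) = a(|p̂−k̂|)/|p̂−k̂|^{2+α}.) -/
open MeasureTheory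
open scoped RealInnerProductSpace

theorem lint_inv_sq_top {F : Type*} [NormedAddCommGroup F] [NormedSpace ℝ F]
    [FiniteDimensional ℝ F] [MeasurableSpace F] [BorelSpace F] [Nontrivial F]
    (hF : Module.finrank ℝ F = 2) (μ : Measure F) [μ.IsAddHaarMeasure] (c r : ℝ) (hc : 0 < c)
    (hr : 0 < r) :
    ∫⁻ y in Metric.ball (0 : F) r, ENNReal.ofReal (c / ‖y‖ ^ 2) ∂μ = ⊤ := by
  by_contra hne
  have hI : IntegrableOn (fun y : F => c / ‖y‖ ^ 2) (Metric.ball (0 : F) r) μ := by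
    refine ⟨(by fun_prop : Measurable fun y : F => c / ‖y‖ ^ 2).aestronglyMeasurable, ?_⟩
    rw [hasFiniteIntegral_iff_ofReal (Filter.Eventually.of_forall fun y => by positivity)]
    exact lt_top_iff_ne_top.2 hne
  rw [integrableOn_fun_norm_addHaar μ (f := fun t => c / t ^ 2), hF] at hI
  have h2 : IntegrableOn (fun x : ℝ => x ^ (-1 : ℝ)) (Set.Ioo 0 r) := by
    refine IntegrableOn.congr_fun (Integrable.const_mul hI c⁻¹) ?_ measurableSet_Ioo
    intro x hx
    have := hx.1
    simp only [Real.rpow_neg_one, smul_eq_mul]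
    field_simp
    norm_num
  rw [intervalIntegral.integrableOn_Ioo_rpow_iff hr] at h2
  exact lt_irrefl _ h2

/-- The total scattering cross section of the singular kernel
`Φ(|p̂ − k̂|) = a(|p̂−k̂|)/|p̂−k̂|^{2+α}` is infinite for `α ∈ [0,2)`:
the mean free time vanishes. -/
theorem stmt0 (a : ℝ → ℝ) (ha : ContinuousOn a (Set.Ici 0))
    (hapos : ∀ x ∈ Set.Ici (0 : ℝ), 0 ≤ a x) (ha0 : 0 < a 0)
    (α : ℝ) (hα0 : 0 ≤ α) (hα2 : α < 2)
    (k : EuclideanSpace ℝ (Fin 3)) (hk : ‖k‖ = 1) :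
    ∫⁻ p in Metric.sphere (0 : EuclideanSpace ℝ (Fin 3)) 1,
      ENNReal.ofReal (a ‖p - k‖ / ‖p - k‖ ^ (2 + α)) ∂μH[2] = ⊤ := by
  have hk0 : k ≠ 0 := by
    intro h
    simp [h] at hk
  have hfact : Fact (Module.finrank ℝ (EuclideanSpace ℝ (Fin 3)) = 2 + 1) := ⟨by simp⟩
  set K := (Submodule.span ℝ {k})ᗮ with hK
  have hdim : Module.finrank ℝ K = 2 := Submodule.finrank_orthogonal_span_singleton hk0
  have hnt : Nontrivial K := Module.nontrivial_of_finrank_pos (R := ℝ) (by omega)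
  have hhaar : (μH[2] : Measure K).IsAddHaarMeasure := by
    have := isAddHaarMeasure_hausdorffMeasure (E := K)
    rw [hdim] at this
    exact_mod_cast this
  have hkk : ⟪k, k⟫ = 1 := by simp [hk]
  let P := K.orthogonalProjectionOnto
  have hP : ∀ p, (P p : EuclideanSpace ℝ (Fin 3)) = p - ⟪k, p⟫ • k := by
    intro p
    have h := Submodule.starProjection_orthogonal_val (K := Submodule.span ℝ {k}) p
    rw [Submodule.starProjection_unit_singleton ℝ hk] at h
    exact h
  have hPn : ∀ p, ‖P p‖ ^ 2 = ‖p‖ ^ 2 - ⟪k, p⟫ ^ 2 := by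
    intro p
    rw [show ‖P p‖ = ‖(P p : EuclideanSpace ℝ (Fin 3))‖ from rfl, hP, norm_sub_sq_real, inner_smul_right, norm_smul, hk,
      real_inner_comm k p, Real.norm_eq_abs, mul_one, sq_abs]
    ring
  have hPmeas : Measurable P := P.continuous.measurable
  -- choose δ
  obtain ⟨δ, hδ, hδa⟩ : ∃ δ > 0, ∀ x, 0 ≤ x → x < δ → a 0 / 2 ≤ a x := by
    have h := (ha 0 (Set.mem_Ici.2 le_rfl)).eventually (lt_mem_nhds (half_lt_self ha0))
    obtain ⟨δ, hδ, h⟩ := Metric.mem_nhdsWithin_iff.1 h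
    refine ⟨δ, hδ, fun x hx hxd => ?_⟩
    have : x ∈ Metric.ball (0 : ℝ) δ ∩ Set.Ici 0 := ⟨by simpa [abs_of_nonneg hx] using hxd, hx⟩
    exact le_of_lt (h this)
  obtain ⟨r, hr, hrδ, hr1⟩ : ∃ r > 0, 2 * r ≤ δ ∧ 2 * r ≤ 1 :=
    ⟨min δ 1 / 2, by positivity, by linarith [min_le_left δ 1], by linarith [min_le_right δ 1]⟩
  set H : Set (EuclideanSpace ℝ (Fin 3)) := Metric.sphere 0 1 ∩ {p | 0 ≤ ⟪k, p⟫} with hH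
  have hHm : MeasurableSet H :=
    (Metric.isClosed_sphere.inter (isClosed_le (by fun_prop) (by fun_prop))).measurableSet
  set g : K → ENNReal := (Metric.ball (0 : K) r).indicator
    (fun y => ENNReal.ofReal (a 0 / 4 / ‖y‖ ^ 2)) with hg
  have hgm : Measurable g := Measurable.indicator (by fun_prop) measurableSet_ball
  have hle : (μH[2] : Measure K).restrict (Metric.ball 0 1) ≤ (μH[2].restrict H).map P := by
    rw [Measure.le_iff]
    intro s hs
    rw [Measure.map_apply hPmeas hs, Measure.restrict_apply hs,
      Measure.restrict_apply (hPmeas hs)]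
    have hsub : s ∩ Metric.ball 0 1 ⊆ P '' (P ⁻¹' s ∩ H) := by
      rintro y ⟨hys, hy1⟩
      have hy1 : ‖y‖ < 1 := by simpa using hy1
      have hky : ⟪k, (y : EuclideanSpace ℝ (Fin 3))⟫ = 0 :=
        Submodule.mem_orthogonal_singleton_iff_inner_right.1 y.2
      have hs0 : 0 ≤ 1 - ‖y‖ ^ 2 := by nlinarith [norm_nonneg y]
      set q : EuclideanSpace ℝ (Fin 3) := y + √(1 - ‖y‖ ^ 2) • k with hq
      have hkq : ⟪k, q⟫ = √(1 - ‖y‖ ^ 2) := by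
        rw [hq, inner_add_right, hky, inner_smul_right, hkk]; ring
      have hPq : P q = y := by
        apply Subtype.ext
        rw [hP, hkq, hq]; abel
      refine ⟨q, ⟨by simpa [hPq] using hys, ?_, ?_⟩, hPq⟩
      · have := hPn q
        rw [hPq, hkq, Real.sq_sqrt hs0] at this
        have h1 : ‖q‖ ^ 2 = 1 := by linarith
        rw [mem_sphere_zero_iff_norm]
        nlinarith [norm_nonneg q]
      · simp only [Set.mem_ofPred_eq, hkq]; positivity
    refine (measure_mono hsub).trans ?_
    have := (Submodule.lipschitzWith_orthogonalProjectionOnto K).hausdorffMeasure_image_le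
      (d := 2) (by norm_num) (P ⁻¹' s ∩ H)
    simpa using this
  rw [eq_top_iff]
  calc (⊤ : ENNReal) = ∫⁻ y in Metric.ball (0 : K) r, ENNReal.ofReal (a 0 / 4 / ‖y‖ ^ 2) ∂μH[2] :=
        (lint_inv_sq_top hdim _ _ r (by positivity) hr).symm
    _ = ∫⁻ y in Metric.ball (0 : K) 1, g y ∂μH[2] := by
        rw [hg, lintegral_indicator measurableSet_ball, Measure.restrict_restrict measurableSet_ball,
          Set.inter_eq_left.2 (Metric.ball_subset_ball (by linarith))]
    _ ≤ ∫⁻ y, g y ∂((μH[2].restrict H).map P) := lintegral_mono' hle le_rfl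
    _ = ∫⁻ p in H, g (P p) ∂μH[2] := lintegral_map hgm hPmeas
    _ ≤ ∫⁻ p in H, ENNReal.ofReal (a ‖p - k‖ / ‖p - k‖ ^ (2 + α)) ∂μH[2] := by
        refine setLIntegral_mono' hHm fun p hp => ?_
        by_cases hpr : P p ∈ Metric.ball (0 : K) r
        · rw [hg, Set.indicator_of_mem hpr]
          apply ENNReal.ofReal_le_ofReal
          have hpr : ‖P p‖ < r := by simpa using hpr
          have hp1 : ‖p‖ = 1 := by simpa using hp.1
          have hp2 : 0 ≤ ⟪k, p⟫ := hp.2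
          have hn := hPn p
          have hd : ‖p - k‖ ^ 2 = 2 - 2 * ⟪k, p⟫ := by
            rw [norm_sub_sq_real, hp1, hk, real_inner_comm]; ring
          rw [hp1] at hn
          have hc1 : ⟪k, p⟫ ≤ 1 := by nlinarith [sq_nonneg ‖p - k‖]
          have hdn : ‖p - k‖ ^ 2 ≤ 2 * ‖P p‖ ^ 2 := by nlinarith
          have hnn := norm_nonneg (P p)
          have hdlt : ‖p - k‖ < 2 * r := by
            apply lt_of_pow_lt_pow_left₀ 2 (by positivity)
            nlinarith
          rcases (norm_nonneg (p - k)).eq_or_lt with h0 | h0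
          · have : ‖P p‖ = 0 := by
              rw [← h0] at hd
              have : ⟪k, p⟫ = 1 := by linarith
              rw [this] at hn
              nlinarith
            rw [this]
            simp only [ne_eq, OfNat.ofNat_ne_zero, not_false_eq_true, zero_pow, div_zero]
            exact div_nonneg (hapos _ (norm_nonneg _)) (by positivity)
          · have hpow : ‖p - k‖ ^ (2 + α) ≤ ‖p - k‖ ^ 2 := by
              rw [← Real.rpow_two]
              exact Real.rpow_le_rpow_of_exponent_ge h0 (by linarith) (by linarith)
            have hPpos : 0 < ‖P p‖ ^ 2 := by nlinarith
            have haa := hδa ‖p - k‖ h0.le (by linarith)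
            calc a 0 / 4 / ‖P p‖ ^ 2 = (a 0 / 2) / (2 * ‖P p‖ ^ 2) := by field_simp; norm_num
              _ ≤ a ‖p - k‖ / ‖p - k‖ ^ (2 + α) :=
                div_le_div₀ (hapos _ h0.le) haa (by positivity) (hpow.trans hdn)
        · rw [hg, Set.indicator_of_notMem hpr]; exact zero_le
    _ ≤ _ := lintegral_mono_set Set.inter_subset_left
end

section
/- Let ε ∈ (0,1) and let α satisfy 0 ≤ α ≤ α_M < 2, and set r_ε := √(1 − (1−ε)²)/(1−ε). Then (1/(4! · 2^{1+α/2})) ∫_{{h ∈ ℝ² : ‖h‖ ≤ r_ε}} ‖h‖⁴ / (1 − 1/√(1+‖h‖²))^{1+α/2} dh ≤ (π/3) · ε^{2−α_M/2} / (1−ε)⁶. -/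
open MeasureTheory

lemma aux_pt (ε : ℝ) (h0 : 0 < ε) (h1' : ε < 1) (α : ℝ) (h1 : 0 ≤ α) (h3 : α < 2) (t : ℝ)
    (ht : t ^ 2 ≤ (1 - (1 - ε) ^ 2) / (1 - ε) ^ 2) :
    ‖t ^ 4 / (1 - 1 / Real.sqrt (1 + t ^ 2)) ^ (1 + α / 2)‖
      ≤ 4 * ε ^ (1 - α / 2) / (1 - ε) ^ 4 := by
  have hd : 0 < 1 - ε := by linarith
  have hR : 0 ≤ 4 * ε ^ (1 - α / 2) / (1 - ε) ^ 4 := by positivity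
  rcases eq_or_ne t 0 with rfl | hne
  · simpa using hR
  have ht2 : 0 < t ^ 2 := by positivity
  have hs2 : Real.sqrt (1 + t ^ 2) ^ 2 = 1 + t ^ 2 := Real.sq_sqrt (by positivity)
  have hs1 : 1 < Real.sqrt (1 + t ^ 2) := Real.lt_sqrt_of_sq_lt (by linarith)
  have hsd : Real.sqrt (1 + t ^ 2) * (1 - ε) ≤ 1 := by
    rw [le_div_iff₀ (by positivity)] at ht
    have : (Real.sqrt (1 + t ^ 2) * (1 - ε)) ^ 2 ≤ 1 := by
      rw [mul_pow, hs2]; linarith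
    exact (sq_le_one_iff₀ (by positivity)).1 this
  set s := Real.sqrt (1 + t ^ 2) with hs
  have hsp : 0 < s := by linarith
  have hw : 0 < 1 - 1 / s := by
    have : 1 / s < 1 := by rw [div_lt_one hsp]; exact hs1
    linarith
  have hwe : 1 - 1 / s ≤ ε := by
    have : 1 - ε ≤ 1 / s := by rw [le_div_iff₀ hsp]; linarith
    linarith
  have ht4 : t ^ 4 = (1 - 1 / s) ^ (2:ℝ) * (s ^ 2 * (s + 1) ^ 2) := by
    rw [Real.rpow_two]
    have : t ^ 4 = (s ^ 2 - 1) ^ 2 := by rw [hs2]; ring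
    rw [this]; field_simp; ring
  have hs' : s ≤ 1 / (1 - ε) := by rw [le_div_iff₀ hd]; exact hsd
  have e1 : t ^ 4 / (1 - 1 / s) ^ (1 + α / 2)
      = (1 - 1 / s) ^ (1 - α / 2) * (s ^ 2 * (s + 1) ^ 2) := by
    rw [ht4, mul_div_right_comm, ← Real.rpow_sub hw]
    congr 2; ring
  rw [e1, Real.norm_of_nonneg (by positivity)]
  have a1 : (1 - 1 / s) ^ (1 - α / 2) ≤ ε ^ (1 - α / 2) :=
    Real.rpow_le_rpow hw.le hwe (by linarith)
  have a2 : s ^ 2 * (s + 1) ^ 2 ≤ (1 / (1 - ε)) ^ 2 * (2 * (1 / (1 - ε))) ^ 2 := by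
    gcongr
    linarith
  calc _ ≤ ε ^ (1 - α / 2) * ((1 / (1 - ε)) ^ 2 * (2 * (1 / (1 - ε))) ^ 2) := by gcongr
    _ = _ := by field_simp; ring

open MeasureTheory

/-- Bound on the fourth-order Taylor remainder term `D₄`:
`(1/(4!·2^{1+α/2})) ∫_{‖h‖≤r_ε} ‖h‖⁴/(1 − 1/√(1+‖h‖²))^{1+α/2} dh
  ≤ (π/3) ε^{2−α_M/2}/(1−ε)⁶`, with `r_ε = √(1−(1−ε)²)/(1−ε)`. -/
theorem stmt8 (ε : ℝ) (hε : ε ∈ Set.Ioo (0:ℝ) 1) (α αM : ℝ)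
    (h1 : 0 ≤ α) (h2 : α ≤ αM) (h3 : αM < 2)
    (r : ℝ) (hr : r = Real.sqrt (1 - (1 - ε) ^ 2) / (1 - ε)) :
    (1 / ((Nat.factorial 4 : ℝ) * 2 ^ (1 + α / 2))) *
      ∫ h in Metric.closedBall (0 : EuclideanSpace ℝ (Fin 2)) r,
        ‖h‖ ^ 4 / (1 - 1 / Real.sqrt (1 + ‖h‖ ^ 2)) ^ (1 + α / 2)
      ≤ (Real.pi / 3) * ε ^ (2 - αM / 2) / (1 - ε) ^ 6 := by
  obtain ⟨h0, hlt⟩ := hε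
  have hd : 0 < 1 - ε := by linarith
  have hq : 0 ≤ 1 - (1 - ε) ^ 2 := by nlinarith
  have hr0 : 0 ≤ r := by rw [hr]; positivity
  have hr2 : r ^ 2 = (1 - (1 - ε) ^ 2) / (1 - ε) ^ 2 := by
    rw [hr, div_pow, Real.sq_sqrt hq]
  have hvol : volume.real (Metric.closedBall (0 : EuclideanSpace ℝ (Fin 2)) r)
      = r ^ 2 * Real.pi := by
    rw [Measure.real, EuclideanSpace.volume_closedBall_fin_two]
    simp [ENNReal.toReal_ofReal hr0, Real.pi_pos.le]
  have hI := norm_setIntegral_le_of_norm_le_const (μ := volume)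
    (s := Metric.closedBall (0 : EuclideanSpace ℝ (Fin 2)) r)
    (f := fun h => ‖h‖ ^ 4 / (1 - 1 / Real.sqrt (1 + ‖h‖ ^ 2)) ^ (1 + α / 2))
    (C := 4 * ε ^ (1 - α / 2) / (1 - ε) ^ 4) measure_closedBall_lt_top (by
      intro x hx
      apply aux_pt ε h0 hlt α h1 (by linarith)
      rw [← hr2]
      have : ‖x‖ ≤ r := by simpa using hx
      gcongr)
  rw [hvol, hr2] at hI
  have hI' := (le_abs_self _).trans hI
  have hp : (2:ℝ) ≤ 2 ^ (1 + α / 2) := by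
    have := Real.rpow_le_rpow_of_exponent_le (x := 2) (by norm_num) (show 1 ≤ 1 + α / 2 by linarith)
    simpa using this
  have hc : 1 / ((Nat.factorial 4 : ℝ) * 2 ^ (1 + α / 2)) ≤ 1 / 48 := by
    have : (Nat.factorial 4 : ℝ) = 24 := by norm_num [Nat.factorial]
    rw [this]
    apply one_div_le_one_div_of_le (by norm_num); linarith
  have hee : ε ^ (1 - α / 2) * ε ≤ ε ^ (2 - αM / 2) := by
    rw [← Real.rpow_add_one h0.ne']
    exact Real.rpow_le_rpow_of_exponent_ge h0 hlt.le (by linarith)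
  have hB : 1 - (1 - ε) ^ 2 ≤ 2 * ε := by nlinarith
  have hpi := Real.pi_pos
  calc _ ≤ 1 / ((Nat.factorial 4 : ℝ) * 2 ^ (1 + α / 2)) *
        (4 * ε ^ (1 - α / 2) / (1 - ε) ^ 4 * ((1 - (1 - ε) ^ 2) / (1 - ε) ^ 2 * Real.pi)) := by
        gcongr
    _ ≤ 1 / 48 * (4 * ε ^ (1 - α / 2) / (1 - ε) ^ 4 * (2 * ε / (1 - ε) ^ 2 * Real.pi)) := by
        gcongr
    _ = (Real.pi / 6) * (ε ^ (1 - α / 2) * ε) / (1 - ε) ^ 6 := by field_simp; ring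
    _ ≤ (Real.pi / 3) * ε ^ (2 - αM / 2) / (1 - ε) ^ 6 := by
        gcongr
        norm_num
end

section
/- Let a : [0,∞) → ℝ be twice continuously differentiable with a'(0) = 0, let ε ∈ (0,1], let α satisfy 0 ≤ α ≤ α_M < 2, and set r'_ε := √(1 − (1−ε)²)/(2−ε). Then 2^{1−α} π · | ∫_0^{r'_ε} a(2v/√(1+v²)) v^{1−α} dv − a(0) (r'_ε)^{2−α}/(2−α) | ≤ 2⁴ π · sup_{w ∈ [0, 2√(2ε)]} |a''(w)| · ε^{2−α_M/2}. In particular, the auxiliary diffusion coefficient σ̃²_ε = 2^{1−α} π λ ∫_0^{r'_ε} a(2v/√(1+v²)) v^{1−α} dv differs from σ²_ε = 2^{1−α} π λ a(0) (r'_ε)^{2−α}/(2−α) by at most 2⁴ π λ sup_{[0,2√(2ε)]}|a''| · ε^{2−α_M/2} for any λ ≥ 0. -/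
open MeasureTheory

/-- Comparison of the auxiliary diffusion coefficient
`σ̃²_ε = 2^{1−α} π λ ∫_0^{r'_ε} a(2v/√(1+v²)) v^{1−α} dv` with
`σ²_ε = 2^{1−α} π λ a(0) (r'_ε)^{2−α}/(2−α)`, for `a` twice continuously
differentiable with `a'(0) = 0`, where `r'_ε = √(1−(1−ε)²)/(2−ε)`. -/
theorem stmt9 (a : ℝ → ℝ) (ha : ContDiff ℝ 2 a) (ha' : deriv a 0 = 0)
    (ε : ℝ) (hε0 : 0 < ε) (hε1 : ε ≤ 1)
    (α αM : ℝ) (h1 : 0 ≤ α) (h2 : α ≤ αM) (h3 : αM < 2)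
    (r : ℝ) (hr : r = Real.sqrt (1 - (1 - ε) ^ 2) / (2 - ε))
    (M : ℝ) (hM : ∀ w ∈ Set.Icc (0:ℝ) (2 * Real.sqrt (2 * ε)), |deriv (deriv a) w| ≤ M) :
    2 ^ (1 - α) * Real.pi *
        |(∫ v in (0:ℝ)..r, a (2 * v / Real.sqrt (1 + v ^ 2)) * v ^ (1 - α))
            - a 0 * r ^ (2 - α) / (2 - α)|
      ≤ 2 ^ (4:ℕ) * Real.pi * M * ε ^ (2 - αM / 2)
    ∧ ∀ lam : ℝ, 0 ≤ lam →
        |2 ^ (1 - α) * Real.pi * lam *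
            (∫ v in (0:ℝ)..r, a (2 * v / Real.sqrt (1 + v ^ 2)) * v ^ (1 - α))
          - 2 ^ (1 - α) * Real.pi * lam * (a 0 * r ^ (2 - α) / (2 - α))|
        ≤ 2 ^ (4:ℕ) * Real.pi * lam * M * ε ^ (2 - αM / 2) := by
  have hMd : ∀ w ∈ Set.Icc (0:ℝ) (2 * Real.sqrt (2 * ε)), ‖deriv (deriv a) w‖ ≤ M := hM
  have hM0 : 0 ≤ M := (abs_nonneg _).trans (hM 0 ⟨le_refl _, by positivity⟩)
  have hda : Differentiable ℝ a := ha.differentiable (by norm_num)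
  have hdda : Differentiable ℝ (deriv a) := by
    have h : ContDiff ℝ (1 + 1) a := by norm_num; exact ha
    exact (contDiff_succ_iff_deriv.1 h).2.2.differentiable (by norm_num)
  have first : ∀ w ∈ Set.Icc (0:ℝ) (2 * Real.sqrt (2 * ε)), ‖deriv a w‖ ≤ M * w := by
    intro w hw
    have := (convex_Icc (0:ℝ) (2 * Real.sqrt (2 * ε))).norm_image_sub_le_of_norm_deriv_le
      (fun x _ => hdda x) hMd ⟨le_refl _, by positivity⟩ hw
    simpa [ha', abs_of_nonneg hw.1] using this
  have second : ∀ w ∈ Set.Icc (0:ℝ) (2 * Real.sqrt (2 * ε)), |a w - a 0| ≤ M * w ^ 2 := by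
    intro w hw
    have := (convex_Icc (0:ℝ) w).norm_image_sub_le_of_norm_deriv_le (f := a) (C := M * w)
      (fun x _ => hda x) (fun x hx => (first x ⟨hx.1, hx.2.trans hw.2⟩).trans
        (mul_le_mul_of_nonneg_left hx.2 hM0)) ⟨le_refl _, hw.1⟩ ⟨hw.1, le_refl _⟩
    rw [Real.norm_eq_abs, Real.norm_eq_abs, sub_zero, abs_of_nonneg hw.1] at this
    linarith [this, sq w, mul_assoc M w w]
  have hr0 : 0 < r := by
    rw [hr]
    exact div_pos (Real.sqrt_pos.2 (by nlinarith)) (by linarith)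
  have hrε : r ≤ Real.sqrt ε := by
    apply Real.le_sqrt_of_sq_le
    rw [hr, div_pow, Real.sq_sqrt (by nlinarith), div_le_iff₀ (by nlinarith)]
    have : 0 ≤ ε * ((2 - ε) * (1 - ε)) :=
      mul_nonneg hε0.le (mul_nonneg (by linarith) (by linarith))
    nlinarith
  have hsε : Real.sqrt ε ≤ Real.sqrt (2 * ε) := Real.sqrt_le_sqrt (by linarith)
  have hint : IntervalIntegrable (fun v : ℝ => v ^ (1 - α)) volume 0 r :=
    intervalIntegral.intervalIntegrable_rpow' (by linarith)
  have hcont : Continuous (fun v : ℝ => a (2 * v / Real.sqrt (1 + v ^ 2))) := by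
    apply ha.continuous.comp
    apply Continuous.div (by fun_prop) (by fun_prop)
    intro v
    positivity
  have hint1 : IntervalIntegrable
      (fun v : ℝ => a (2 * v / Real.sqrt (1 + v ^ 2)) * v ^ (1 - α)) volume 0 r :=
    hint.continuousOn_mul hcont.continuousOn
  have hint2 : IntervalIntegrable (fun v : ℝ => a 0 * v ^ (1 - α)) volume 0 r :=
    hint.const_mul _
  have hval : ∫ v in (0:ℝ)..r, a 0 * v ^ (1 - α) = a 0 * r ^ (2 - α) / (2 - α) := by
    rw [intervalIntegral.integral_const_mul, integral_rpow (Or.inl (by linarith))]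
    have e : 1 - α + 1 = 2 - α := by ring
    rw [e, Real.zero_rpow (by linarith)]
    ring
  have key : |(∫ v in (0:ℝ)..r, a (2 * v / Real.sqrt (1 + v ^ 2)) * v ^ (1 - α))
            - a 0 * r ^ (2 - α) / (2 - α)| ≤ 4 * M * r ^ (4 - α) := by
    rw [← hval, ← intervalIntegral.integral_sub hint1 hint2, ← Real.norm_eq_abs]
    have hb := intervalIntegral.norm_integral_le_of_norm_le_const (a := 0) (b := r)
      (f := fun v : ℝ => a (2 * v / Real.sqrt (1 + v ^ 2)) * v ^ (1 - α) - a 0 * v ^ (1 - α))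
      (C := 4 * M * r ^ (3 - α)) (by
        intro v hv
        rw [Set.uIoc_of_le hr0.le] at hv
        have hv0 := hv.1
        have hs : 1 ≤ Real.sqrt (1 + v ^ 2) := Real.one_le_sqrt.2 (by nlinarith)
        have hw : 2 * v / Real.sqrt (1 + v ^ 2) ≤ 2 * v := div_le_self (by linarith) hs
        have hw0 : 0 ≤ 2 * v / Real.sqrt (1 + v ^ 2) := by positivity
        have h := second _ ⟨hw0, by linarith [hv.2]⟩
        have h' : |a (2 * v / Real.sqrt (1 + v ^ 2)) - a 0| ≤ M * (2 * v) ^ 2 :=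
          h.trans (mul_le_mul_of_nonneg_left (pow_le_pow_left₀ hw0 hw 2) hM0)
        rw [← sub_mul, Real.norm_eq_abs, abs_mul, abs_of_nonneg (Real.rpow_nonneg hv0.le _)]
        calc _ ≤ M * (2 * v) ^ 2 * v ^ (1 - α) :=
              mul_le_mul_of_nonneg_right h' (Real.rpow_nonneg hv0.le _)
          _ = 4 * M * v ^ (3 - α) := by
              have e : 3 - α = (2:ℕ) + (1 - α) := by push_cast; ring
              rw [e, Real.rpow_add hv0, Real.rpow_natCast]
              ring
          _ ≤ _ := mul_le_mul_of_nonneg_left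
              (Real.rpow_le_rpow hv0.le hv.2 (by linarith)) (by linarith))
    refine hb.trans (le_of_eq ?_)
    have e : 4 - α = (3 - α) + 1 := by ring
    rw [e, Real.rpow_add hr0, Real.rpow_one, sub_zero, abs_of_pos hr0]
    ring
  have hpow : r ^ (4 - α) ≤ ε ^ (2 - αM / 2) := by
    calc r ^ (4 - α) ≤ (Real.sqrt ε) ^ (4 - α) :=
          Real.rpow_le_rpow hr0.le hrε (by linarith)
      _ = ε ^ (2 - α / 2) := by
          rw [Real.sqrt_eq_rpow, ← Real.rpow_mul hε0.le]
          congr 1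
          ring
      _ ≤ _ := Real.rpow_le_rpow_of_exponent_ge hε0 hε1 (by linarith)
  have h2le : (2:ℝ) ^ (1 - α) ≤ 2 := by
    calc (2:ℝ) ^ (1 - α) ≤ 2 ^ (1:ℝ) :=
          Real.rpow_le_rpow_of_exponent_le (by norm_num) (by linarith)
      _ = 2 := Real.rpow_one 2
  have hE : 0 ≤ ε ^ (2 - αM / 2) := Real.rpow_nonneg hε0.le _
  have main : 2 ^ (1 - α) * Real.pi *
        |(∫ v in (0:ℝ)..r, a (2 * v / Real.sqrt (1 + v ^ 2)) * v ^ (1 - α))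
            - a 0 * r ^ (2 - α) / (2 - α)|
      ≤ 2 ^ (4:ℕ) * Real.pi * M * ε ^ (2 - αM / 2) := by
    have hpi := Real.pi_pos
    calc _ ≤ 2 * Real.pi * (4 * M * ε ^ (2 - αM / 2)) := by
          apply mul_le_mul _ _ (abs_nonneg _) (by positivity)
          · exact mul_le_mul_of_nonneg_right h2le hpi.le
          · exact key.trans (mul_le_mul_of_nonneg_left hpow (by linarith))
      _ ≤ _ := by
          have : 0 ≤ Real.pi * M * ε ^ (2 - αM / 2) := by positivity
          nlinarith
  refine ⟨main, fun lam hl => ?_⟩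
  rw [← mul_sub, abs_mul, abs_of_nonneg (a := 2 ^ (1 - α) * Real.pi * lam) (by positivity)]
  have := mul_le_mul_of_nonneg_left main hl
  linarith
end

section
/- Let a : [0,∞) → [0,∞) be continuous and bounded, let ε ∈ (0,1), let α satisfy 0 ≤ α ≤ α_M < 2, and set r'_ε := √(1 − (1−ε)²)/(2−ε). Then 2^{1−α} π · | ∫_0^{r'_ε} a(2v/√(1+v²)) (1+v²)^{α/2} (1−v²)^{−2} v^{1−α} dv − ∫_0^{r'_ε} a(2v/√(1+v²)) v^{1−α} dv | ≤ 6π (sup a) · ε^{2−α_M/2} / (1−ε)³. -/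
open MeasureTheory

/-- Comparison of the exact second-order (diffusion) coefficient `D̃₂` with the auxiliary
coefficient `σ̃²_ε`:
`2^{1−α} π |∫_0^{r'_ε} a(2v/√(1+v²)) (1+v²)^{α/2} (1−v²)^{−2} v^{1−α} dv
  − ∫_0^{r'_ε} a(2v/√(1+v²)) v^{1−α} dv| ≤ 6π (sup a) ε^{2−α_M/2}/(1−ε)³`,
with `r'_ε = √(1−(1−ε)²)/(2−ε)`. -/
theorem stmt10 (a : ℝ → ℝ) (ha : Continuous a) (hapos : ∀ x, 0 ≤ a x)
    (A : ℝ) (hA : ∀ x, a x ≤ A)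
    (ε : ℝ) (hε : ε ∈ Set.Ioo (0:ℝ) 1)
    (α αM : ℝ) (h1 : 0 ≤ α) (h2 : α ≤ αM) (h3 : αM < 2)
    (r : ℝ) (hr : r = Real.sqrt (1 - (1 - ε) ^ 2) / (2 - ε)) :
    2 ^ (1 - α) * Real.pi *
        |(∫ v in (0:ℝ)..r,
            a (2 * v / Real.sqrt (1 + v ^ 2)) * (1 + v ^ 2) ^ (α / 2) * v ^ (1 - α)
              / (1 - v ^ 2) ^ 2)
          - ∫ v in (0:ℝ)..r, a (2 * v / Real.sqrt (1 + v ^ 2)) * v ^ (1 - α)|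
      ≤ 6 * Real.pi * A * ε ^ (2 - αM / 2) / (1 - ε) ^ 3 := by
  obtain ⟨he0, he1⟩ := hε
  have hA0 : 0 ≤ A := (hapos 0).trans (hA 0)
  have hr0 : 0 ≤ r := by
    rw [hr]; exact div_nonneg (Real.sqrt_nonneg _) (by linarith)
  have hr2 : r ^ 2 ≤ ε := by
    rw [hr, div_pow, Real.sq_sqrt (by nlinarith), div_le_iff₀ (by nlinarith)]
    nlinarith [mul_pos he0 (sub_pos.2 he1), mul_pos (mul_pos he0 (sub_pos.2 he1)) (sub_pos.2 he1)]
  have hv2 : ∀ v ∈ Set.Icc 0 r, v ^ 2 ≤ ε := fun v hv =>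
    (pow_le_pow_left₀ hv.1 hv.2 2).trans hr2
  have hca : Continuous fun v : ℝ => a (2 * v / Real.sqrt (1 + v ^ 2)) := by
    apply ha.comp
    apply Continuous.div (by fun_prop) (by fun_prop)
    intro v
    positivity
  have hw : IntervalIntegrable (fun v : ℝ => v ^ (1 - α)) volume 0 r :=
    intervalIntegral.intervalIntegrable_rpow' (by linarith)
  have hI2 : IntervalIntegrable
      (fun v : ℝ => a (2 * v / Real.sqrt (1 + v ^ 2)) * v ^ (1 - α)) volume 0 r :=
    hw.continuousOn_mul hca.continuousOn
  have hI1 : IntervalIntegrable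
      (fun v : ℝ => a (2 * v / Real.sqrt (1 + v ^ 2)) * (1 + v ^ 2) ^ (α / 2) * v ^ (1 - α)
              / (1 - v ^ 2) ^ 2) volume 0 r := by
    have hc : ContinuousOn (fun v : ℝ => a (2 * v / Real.sqrt (1 + v ^ 2)) *
        (1 + v ^ 2) ^ (α / 2) / (1 - v ^ 2) ^ 2) (Set.uIcc 0 r) := by
      apply ContinuousOn.div
      · apply ContinuousOn.mul hca.continuousOn
        apply Continuous.continuousOn
        apply Continuous.rpow_const (by fun_prop)
        intro v
        left
        positivity
      · fun_prop
      · intro v hv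
        rw [Set.uIcc_of_le hr0] at hv
        have := hv2 v hv
        have : 0 < 1 - v ^ 2 := by linarith
        positivity
    refine (hw.continuousOn_mul hc).congr ?_
    intro v _
    simp only
    ring
  rw [← intervalIntegral.integral_sub hI1 hI2]
  have hI3 : IntervalIntegrable (fun v : ℝ => 3 * A / (1 - ε) ^ 2 * v ^ (3 - α)) volume 0 r :=
    (intervalIntegral.intervalIntegrable_rpow' (by linarith)).const_mul _
  have key := intervalIntegral.norm_integral_le_of_norm_le (μ := volume) hr0
    (f := fun v : ℝ => a (2 * v / Real.sqrt (1 + v ^ 2)) * (1 + v ^ 2) ^ (α / 2) * v ^ (1 - α)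
              / (1 - v ^ 2) ^ 2 - a (2 * v / Real.sqrt (1 + v ^ 2)) * v ^ (1 - α))
    (g := fun v : ℝ => 3 * A / (1 - ε) ^ 2 * v ^ (3 - α)) (by
      refine Filter.Eventually.of_forall fun v hv => ?_
      have hs := hv2 v ⟨hv.1.le, hv.2⟩
      have hv0 := hv.1
      have hc0 := hapos (2 * v / Real.sqrt (1 + v ^ 2))
      have hcA := hA (2 * v / Real.sqrt (1 + v ^ 2))
      have hw0 : 0 ≤ v ^ (1 - α) := Real.rpow_nonneg hv0.le _
      have hww : v ^ (3 - α) = v ^ 2 * v ^ (1 - α) := by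
        rw [← Real.rpow_natCast, ← Real.rpow_add hv0]
        congr 1
        push_cast
        ring
      have hP1 : 1 ≤ (1 + v ^ 2) ^ (α / 2) :=
        Real.one_le_rpow (by nlinarith) (by linarith)
      have hP2 : (1 + v ^ 2) ^ (α / 2) ≤ 1 + v ^ 2 := by
        calc _ ≤ (1 + v ^ 2) ^ (1 : ℝ) :=
              Real.rpow_le_rpow_of_exponent_le (by nlinarith) (by linarith)
          _ = _ := Real.rpow_one _
      rw [hww]
      generalize a (2 * v / Real.sqrt (1 + v ^ 2)) = c at *
      generalize (1 + v ^ 2) ^ (α / 2) = P at *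
      generalize v ^ (1 - α) = w at *
      have hs0 : 0 < v ^ 2 := by positivity
      generalize v ^ 2 = s at *
      have h1s : 0 < 1 - s := by linarith
      have hd : 0 < (1 - s) ^ 2 := by positivity
      have hq0 : 0 ≤ P / (1 - s) ^ 2 - 1 := by
        rw [sub_nonneg, le_div_iff₀ hd]
        nlinarith
      have hq1 : P / (1 - s) ^ 2 - 1 ≤ 3 * s / (1 - ε) ^ 2 := by
        calc P / (1 - s) ^ 2 - 1 ≤ 3 * s / (1 - s) ^ 2 := by
              rw [div_sub_one hd.ne']
              apply div_le_div_of_nonneg_right _ hd.le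
              nlinarith
          _ ≤ _ := by
              have : 0 < 1 - ε := by linarith
              gcongr
      have e : c * P * w / (1 - s) ^ 2 - c * w = (c * w) * (P / (1 - s) ^ 2 - 1) := by ring
      rw [e, Real.norm_of_nonneg (by positivity)]
      calc (c * w) * (P / (1 - s) ^ 2 - 1) ≤ (A * w) * (3 * s / (1 - ε) ^ 2) := by gcongr
        _ = _ := by ring) hI3
  rw [Real.norm_eq_abs, intervalIntegral.integral_const_mul,
    integral_rpow (Or.inl (by linarith)), Real.zero_rpow (by linarith)] at key
  have hrp : r ^ (3 - α + 1) ≤ ε ^ (2 - αM / 2) := by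
    have e : r ^ (3 - α + 1) = (r ^ 2) ^ (2 - α / 2) := by
      rw [← Real.rpow_natCast, ← Real.rpow_mul hr0]
      congr 1
      push_cast
      ring
    rw [e]
    exact (Real.rpow_le_rpow (by positivity) hr2 (by linarith)).trans
      (Real.rpow_le_rpow_of_exponent_ge he0 he1.le (by linarith))
  have h2a : (2 : ℝ) ^ (1 - α) ≤ 2 := by
    calc _ ≤ (2 : ℝ) ^ (1 : ℝ) :=
          Real.rpow_le_rpow_of_exponent_le (by norm_num) (by linarith)
      _ = _ := Real.rpow_one _
  have hE : 0 ≤ ε ^ (2 - αM / 2) := by positivity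
  have hone : 0 < 1 - ε := by linarith
  have hdiv : (r ^ (3 - α + 1) - 0) / (3 - α + 1) ≤ ε ^ (2 - αM / 2) := by
    rw [sub_zero, div_le_iff₀ (by linarith)]
    nlinarith
  have hpw : (1 - ε) ^ 3 ≤ (1 - ε) ^ 2 := by
    apply pow_le_pow_of_le_one hone.le (by linarith) (by norm_num)
  calc _ ≤ 2 * Real.pi * (3 * A / (1 - ε) ^ 2 * ε ^ (2 - αM / 2)) := by
        have := Real.pi_pos
        refine mul_le_mul (by gcongr) (key.trans (by gcongr)) (abs_nonneg _) (by positivity)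
    _ = 6 * Real.pi * A * ε ^ (2 - αM / 2) / (1 - ε) ^ 2 := by ring
    _ ≤ _ := by
        have := Real.pi_pos
        gcongr
end
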